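/- Let ρ be a real C² function on a complex surface M with ∂ρ nonvanishing on X = {ρ = 0}, with (i∂∂̄ρ)² = 0 on X and i∂∂̄ρ ∧ ∂ρ ∧ ∂̄ρ = O(ρ²). Define T_ε := i (1/ε) χ(ρ/ε) ∂ρ ∧ ∂̄ρ for χ ∈ C_0^∞(−1,1), χ ≥ 0, ∫χ = 1. Then i∂∂̄T_ε → 0 as ε → 0 in the sense of currents, so the limit current T = i δ_{ρ=0} ∂ρ ∧ ∂̄ρ is harmonic (i∂∂̄T = 0). -/

import Mathlib

open MeasureTheory Filter

noncomputable section

/-- Standard real basis directions of `ℂ²`. -/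
def ee : Fin 2 → ℂ × ℂ := ![(1, 0), (0, 1)]

/-- Wirtinger derivative `∂g/∂z_j`. -/
def dZ (j : Fin 2) (g : ℂ × ℂ → ℂ) (z : ℂ × ℂ) : ℂ :=
  (fderiv ℝ g z (ee j) - Complex.I * fderiv ℝ g z (Complex.I • ee j)) / 2

/-- Wirtinger derivative `∂g/∂z̄_j`. -/
def dZb (j : Fin 2) (g : ℂ × ℂ → ℂ) (z : ℂ × ℂ) : ℂ :=
  (fderiv ℝ g z (ee j) + Complex.I * fderiv ℝ g z (Complex.I • ee j)) / 2

/-- Coefficient `(∂∂̄g)_{jk̄}` of the complex Hessian. -/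
def hess (g : ℂ × ℂ → ℂ) (j k : Fin 2) (z : ℂ × ℂ) : ℂ :=
  dZ j (dZb k g) z

/-- Coefficient `(∂ρ∧∂̄ρ)_{jk̄}` for a real function `ρ`. -/
def grd (ρ : ℂ × ℂ → ℝ) (j k : Fin 2) (z : ℂ × ℂ) : ℂ :=
  dZ j (fun u => (ρ u : ℂ)) z * dZb k (fun u => (ρ u : ℂ)) z

/-- Coefficient of the wedge of two `(1,1)`-forms against the volume form on `ℂ²`. -/
def wedge2 (a b : Fin 2 → Fin 2 → ℂ × ℂ → ℂ) (z : ℂ × ℂ) : ℂ :=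
  a 0 0 z * b 1 1 z + a 1 1 z * b 0 0 z - a 0 1 z * b 1 0 z - a 1 0 z * b 0 1 z

theorem hasDerivAt_integral_mul_translate {E : Type*} [NormedAddCommGroup E] [NormedSpace ℝ E]
    [MeasurableSpace E] [BorelSpace E] [FiniteDimensional ℝ E] (μ : Measure E)
    [IsFiniteMeasureOnCompacts μ] {f g : E → ℂ} (hf : Continuous f) (hg : ContDiff ℝ 1 g)
    (v : E) {K : Set E} (hK : IsCompact K)
    (h0 : ∀ t : ℝ, |t| ≤ 1 → ∀ x, x ∉ K → f x * g (x + t • v) = 0)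
    (h1 : ∀ t : ℝ, |t| ≤ 1 → ∀ x, x ∉ K → f x * fderiv ℝ g (x + t • v) v = 0) :
    HasDerivAt (fun t : ℝ => ∫ x, f x * g (x + t • v) ∂μ) (∫ x, f x * fderiv ℝ g x v ∂μ) 0 := by
  have hg' : Continuous (fderiv ℝ g) := hg.continuous_fderiv one_ne_zero
  have hgc : Continuous g := hg.continuous
  obtain ⟨C, hC⟩ := ((isCompact_Icc (a := (-1 : ℝ)) (b := 1)).prod hK).exists_bound_of_continuousOn
    (f := fun p : ℝ × E => f p.2 * fderiv ℝ g (p.2 + p.1 • v) v) (by fun_prop)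
  have key := hasDerivAt_integral_of_dominated_loc_of_deriv_le (μ := μ) (𝕜 := ℝ)
    (F := fun t x => f x * g (x + t • v)) (F' := fun t x => f x * fderiv ℝ g (x + t • v) v)
    (x₀ := 0) (s := Metric.ball 0 1) (bound := K.indicator fun _ => C)
    (Metric.ball_mem_nhds _ one_pos)
    (Eventually.of_forall fun t => by
      apply Continuous.aestronglyMeasurable; fun_prop)
    (by
      apply Continuous.integrable_of_hasCompactSupport (by fun_prop)
      exact HasCompactSupport.intro hK fun x hx => h0 0 (by simp) x hx)
    (by apply Continuous.aestronglyMeasurable; fun_prop)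
    (Eventually.of_forall fun x t ht => by
      have ht' : |t| ≤ 1 := by simpa using (mem_ball_zero_iff.1 ht).le
      by_cases hx : x ∈ K
      · simpa [hx] using hC (t, x) ⟨abs_le.1 ht', hx⟩
      · simp only [Set.indicator_of_notMem hx]
        rw [h1 t ht' x hx, norm_zero])
    ((integrable_indicator_iff hK.measurableSet).2
      (integrableOn_const hK.measure_lt_top.ne))
    (Eventually.of_forall fun x t _ => by
      have hd : HasFDerivAt g (fderiv ℝ g (x + t • v)) (x + t • v) :=
        ((hg.differentiable one_ne_zero) _).hasFDerivAt
      have hl : HasDerivAt (fun t : ℝ => x + t • v) v t := by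
        simpa using ((hasDerivAt_id t).smul_const v).const_add x
      exact (hd.comp_hasDerivAt t hl).const_mul (f x))
  simpa using key.2

theorem integral_fderiv_mul_fderiv_comm {E : Type*} [NormedAddCommGroup E] [NormedSpace ℝ E]
    [MeasurableSpace E] [BorelSpace E] [FiniteDimensional ℝ E] (μ : Measure E)
    [μ.IsAddHaarMeasure] {σ η : E → ℂ} (hσ : ContDiff ℝ 1 σ) (hη : ContDiff ℝ 1 η)
    (hc : HasCompactSupport η) (u v : E) :
    ∫ x, fderiv ℝ σ x u * fderiv ℝ η x v ∂μ = ∫ x, fderiv ℝ σ x v * fderiv ℝ η x u ∂μ := by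
  have hσ' : Continuous (fderiv ℝ σ) := hσ.continuous_fderiv one_ne_zero
  have hη' : Continuous (fderiv ℝ η) := hη.continuous_fderiv one_ne_zero
  have hσc : Continuous σ := hσ.continuous
  have hηc : Continuous η := hη.continuous
  have hc' : HasCompactSupport (fderiv ℝ η) := hc.fderiv (𝕜 := ℝ)
  have z0 : ∀ x, x ∉ tsupport η → η x = 0 := fun x hx => image_eq_zero_of_notMem_tsupport hx
  have z1 : ∀ x, x ∉ tsupport η → fderiv ℝ η x = 0 := fun x hx =>
    image_eq_zero_of_notMem_tsupport fun h => hx (tsupport_fderiv_subset ℝ h)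
  have hK : IsCompact ((fun p : ℝ × E => p.2 - p.1 • v) '' (Set.Icc (-1) 1 ×ˢ tsupport η)) :=
    (isCompact_Icc.prod hc).image (by fun_prop)
  have hout : ∀ t : ℝ, |t| ≤ 1 → ∀ x,
      x ∉ (fun p : ℝ × E => p.2 - p.1 • v) '' (Set.Icc (-1) 1 ×ˢ tsupport η) →
      x + t • v ∉ tsupport η := fun t ht x hx h =>
    hx ⟨(t, x + t • v), ⟨abs_le.1 ht, h⟩, by simp⟩
  have A := hasDerivAt_integral_mul_translate μ (f := fun x => fderiv ℝ σ x u) (g := η)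
    (by fun_prop) hη v hK
    (fun t ht x hx => by rw [z0 _ (hout t ht x hx), mul_zero])
    (fun t ht x hx => by rw [z1 _ (hout t ht x hx)]; simp)
  have B := hasDerivAt_integral_mul_translate μ (f := fun x => fderiv ℝ η x u) (g := σ)
    (by fun_prop) hσ (-v) hc
    (fun t ht x hx => by rw [z1 x hx]; simp)
    (fun t ht x hx => by rw [z1 x hx]; simp)
  have heq : ∀ t : ℝ, ∫ x, fderiv ℝ σ x u * η (x + t • v) ∂μ =
      -∫ x, fderiv ℝ η x u * σ (x + t • (-v)) ∂μ := by
    intro t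
    have hfd : ∀ x, fderiv ℝ (fun y => η (y + t • v)) x = fderiv ℝ η (x + t • v) := fun x =>
      fderiv_comp_add_right _
    have hct : HasCompactSupport fun y => η (y + t • v) :=
      hc.comp_homeomorph (Homeomorph.addRight (t • v))
    have hct' : HasCompactSupport fun y => fderiv ℝ η (y + t • v) :=
      hc'.comp_homeomorph (Homeomorph.addRight (t • v))
    have hct'' : HasCompactSupport fun y => fderiv ℝ η (y + t • v) u :=
      hct'.comp_left (g := fun l : E →L[ℝ] ℂ => l u) (by simp)
    have ibp := integral_mul_fderiv_eq_neg_fderiv_mul_of_integrable (μ := μ) (v := u)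
      (f := σ) (g := fun y => η (y + t • v))
      (Continuous.integrable_of_hasCompactSupport (by fun_prop) hct.mul_left)
      (by
        simp only [hfd]
        exact Continuous.integrable_of_hasCompactSupport (by fun_prop) hct''.mul_left)
      (Continuous.integrable_of_hasCompactSupport (by fun_prop) hct.mul_left)
      (fun x _ => hσ.differentiable one_ne_zero x)
      (fun x _ => (hη.comp (contDiff_id.add contDiff_const)).differentiable one_ne_zero x)
    simp only [hfd] at ibp
    rw [← neg_eq_iff_eq_neg, ← ibp, ← integral_add_right_eq_self _ (-(t • v))]
    simp [mul_comm]
  have C := (B.neg).congr_of_eventuallyEq (Eventually.of_forall heq)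
  have := A.unique C
  rw [this, ← integral_neg]
  congr 1 with x
  simp [mul_comm]

instance isAddHaarMeasure_volume_complex_prod :
    (volume : Measure (ℂ × ℂ)).IsAddHaarMeasure :=
  inferInstanceAs ((volume : Measure ℂ).prod volume).IsAddHaarMeasure

theorem integral_add₄ {f₁ f₂ f₃ f₄ : ℂ × ℂ → ℂ} (h₁ : Integrable f₁) (h₂ : Integrable f₂)
    (h₃ : Integrable f₃) (h₄ : Integrable f₄) :
    ∫ z, (f₁ z + f₂ z + f₃ z + f₄ z) =
      (∫ z, f₁ z) + (∫ z, f₂ z) + (∫ z, f₃ z) + ∫ z, f₄ z := by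
  have h₁₂ : Integrable fun z => f₁ z + f₂ z := h₁.add h₂
  have h₁₃ : Integrable fun z => f₁ z + f₂ z + f₃ z := h₁₂.add h₃
  rw [integral_add h₁₃ h₄, integral_add h₁₂ h₃, integral_add h₁ h₂]

theorem integral_sub₅ {f₁ f₂ f₃ f₄ f₅ : ℂ × ℂ → ℂ} (h₁ : Integrable f₁) (h₂ : Integrable f₂)
    (h₃ : Integrable f₃) (h₄ : Integrable f₄) (h₅ : Integrable f₅) :
    ∫ z, (f₁ z - f₂ z - (f₃ z - f₄ z) - f₅ z) =
      (∫ z, f₁ z) - (∫ z, f₂ z) - ((∫ z, f₃ z) - ∫ z, f₄ z) - ∫ z, f₅ z := by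
  have h₁₂ : Integrable fun z => f₁ z - f₂ z := h₁.sub h₂
  have h₃₄ : Integrable fun z => f₃ z - f₄ z := h₃.sub h₄
  have h₁₄ : Integrable fun z => f₁ z - f₂ z - (f₃ z - f₄ z) := h₁₂.sub h₃₄
  rw [integral_sub h₁₄ h₅, integral_sub h₁₂ h₃₄, integral_sub h₁ h₂, integral_sub h₃ h₄]

theorem integral_fderiv_add_mul_comm {σ η : ℂ × ℂ → ℂ} (hσ : ContDiff ℝ 1 σ)
    (hη : ContDiff ℝ 1 η) (hc : HasCompactSupport η) (c : ℂ) (u u' v v' : ℂ × ℂ) :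
    ∫ z, (fderiv ℝ σ z u + c * fderiv ℝ σ z u') / 2 * ((fderiv ℝ η z v + c * fderiv ℝ η z v') / 2) =
      ∫ z, (fderiv ℝ σ z v + c * fderiv ℝ σ z v') / 2 *
        ((fderiv ℝ η z u + c * fderiv ℝ η z u') / 2) := by
  have hσ' : Continuous (fderiv ℝ σ) := hσ.continuous_fderiv one_ne_zero
  have hη' : Continuous (fderiv ℝ η) := hη.continuous_fderiv one_ne_zero
  have hint : ∀ (d : ℂ) (x y : ℂ × ℂ),
      Integrable (fun z => d * (fderiv ℝ σ z x * fderiv ℝ η z y)) := fun d x y => by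
    have h : HasCompactSupport fun z => fderiv ℝ η z y := (hc.fderiv_apply (𝕜 := ℝ) y)
    exact Continuous.integrable_of_hasCompactSupport (by fun_prop) (h.mul_left.mul_left)
  have expand : ∀ x x' y y' : ℂ × ℂ,
      ∫ z, (fderiv ℝ σ z x + c * fderiv ℝ σ z x') / 2 *
        ((fderiv ℝ η z y + c * fderiv ℝ η z y') / 2) =
      1 / 4 * (∫ z, fderiv ℝ σ z x * fderiv ℝ η z y) +
      c / 4 * (∫ z, fderiv ℝ σ z x * fderiv ℝ η z y') +
      c / 4 * (∫ z, fderiv ℝ σ z x' * fderiv ℝ η z y) +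
      c ^ 2 / 4 * (∫ z, fderiv ℝ σ z x' * fderiv ℝ η z y') := by
    intro x x' y y'
    simp only [← integral_const_mul]
    rw [← integral_add₄ (hint _ _ _) (hint _ _ _) (hint _ _ _) (hint _ _ _)]
    congr 1 with z
    ring
  rw [expand, expand, integral_fderiv_mul_fderiv_comm volume hσ hη hc u v,
    integral_fderiv_mul_fderiv_comm volume hσ hη hc u v',
    integral_fderiv_mul_fderiv_comm volume hσ hη hc u' v,
    integral_fderiv_mul_fderiv_comm volume hσ hη hc u' v']
  ring

theorem integral_dZ_mul_dZ_comm {σ η : ℂ × ℂ → ℂ} (hσ : ContDiff ℝ 1 σ)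
    (hη : ContDiff ℝ 1 η) (hc : HasCompactSupport η) (j l : Fin 2) :
    ∫ z, dZ j σ z * dZ l η z = ∫ z, dZ l σ z * dZ j η z := by
  have := integral_fderiv_add_mul_comm hσ hη hc (-Complex.I) (ee j) (Complex.I • ee j)
    (ee l) (Complex.I • ee l)
  simpa only [dZ, neg_mul, ← sub_eq_add_neg] using this

theorem integral_dZb_mul_dZb_comm {σ η : ℂ × ℂ → ℂ} (hσ : ContDiff ℝ 1 σ)
    (hη : ContDiff ℝ 1 η) (hc : HasCompactSupport η) (j l : Fin 2) :
    ∫ z, dZb j σ z * dZb l η z = ∫ z, dZb l σ z * dZb j η z :=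
  integral_fderiv_add_mul_comm hσ hη hc Complex.I (ee j) (Complex.I • ee j)
    (ee l) (Complex.I • ee l)

theorem ContDiff.dZ {g : ℂ × ℂ → ℂ} {m n : WithTop ℕ∞} (hg : ContDiff ℝ n g) (h : m + 1 ≤ n)
    (j : Fin 2) : ContDiff ℝ m (dZ j g) := by
  have h' : ∀ w, ContDiff ℝ m fun z => fderiv ℝ g z w := fun w =>
    (hg.fderiv_right h).clm_apply contDiff_const
  exact ((h' _).sub (contDiff_const.mul (h' _))).div_const 2

theorem ContDiff.dZb {g : ℂ × ℂ → ℂ} {m n : WithTop ℕ∞} (hg : ContDiff ℝ n g) (h : m + 1 ≤ n)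
    (j : Fin 2) : ContDiff ℝ m (dZb j g) := by
  have h' : ∀ w, ContDiff ℝ m fun z => fderiv ℝ g z w := fun w =>
    (hg.fderiv_right h).clm_apply contDiff_const
  exact ((h' _).add (contDiff_const.mul (h' _))).div_const 2

theorem HasCompactSupport.dZ {g : ℂ × ℂ → ℂ} (hg : HasCompactSupport g) (j : Fin 2) :
    HasCompactSupport (dZ j g) :=
  (hg.fderiv (𝕜 := ℝ)).comp_left
    (g := fun l : ℂ × ℂ →L[ℝ] ℂ => (l (ee j) - Complex.I * l (Complex.I • ee j)) / 2) (by simp)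

theorem HasCompactSupport.dZb {g : ℂ × ℂ → ℂ} (hg : HasCompactSupport g) (j : Fin 2) :
    HasCompactSupport (dZb j g) :=
  (hg.fderiv (𝕜 := ℝ)).comp_left
    (g := fun l : ℂ × ℂ →L[ℝ] ℂ => (l (ee j) + Complex.I * l (Complex.I • ee j)) / 2) (by simp)

theorem dZ_mul {f g : ℂ × ℂ → ℂ} (hf : ContDiff ℝ 1 f) (hg : ContDiff ℝ 1 g) (j : Fin 2)
    (z : ℂ × ℂ) : dZ j (fun u => f u * g u) z = dZ j f z * g z + f z * dZ j g z := by
  simp only [dZ, fderiv_fun_mul (hf.differentiable one_ne_zero z) (hg.differentiable one_ne_zero z),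
    add_apply, smul_apply, smul_eq_mul]
  ring

theorem dZb_mul {f g : ℂ × ℂ → ℂ} (hf : ContDiff ℝ 1 f) (hg : ContDiff ℝ 1 g) (j : Fin 2)
    (z : ℂ × ℂ) : dZb j (fun u => f u * g u) z = dZb j f z * g z + f z * dZb j g z := by
  simp only [dZb,
    fderiv_fun_mul (hf.differentiable one_ne_zero z) (hg.differentiable one_ne_zero z),
    add_apply, smul_apply, smul_eq_mul]
  ring

theorem dZb_dZ_comm {g : ℂ × ℂ → ℂ} (hg : ContDiff ℝ 2 g) (j k : Fin 2) (z : ℂ × ℂ) :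
    dZb k (dZ j g) z = dZ j (dZb k g) z := by
  have hd : Differentiable ℝ (fderiv ℝ g) :=
    (hg.fderiv_right (m := 1) (by norm_num)).differentiable one_ne_zero
  have hda : ∀ w : ℂ × ℂ, DifferentiableAt ℝ (fun y => fderiv ℝ g y w) z := fun w =>
    (hd z).clm_apply (differentiableAt_const (𝕜 := ℝ) w)
  have h2 : ∀ w w' : ℂ × ℂ, fderiv ℝ (fun y => fderiv ℝ g y w) z w' = fderiv ℝ (fderiv ℝ g) z w' w := by
    intro w w'
    rw [fderiv_clm_apply (hd z) (differentiableAt_const (𝕜 := ℝ) w)]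
    simp
  have hs : ∀ w w' : ℂ × ℂ, fderiv ℝ (fderiv ℝ g) z w w' = fderiv ℝ (fderiv ℝ g) z w' w :=
    fun w w' => (hg.contDiffAt.isSymmSndFDerivAt (by simp)) w w'
  have e1 : ∀ w, fderiv ℝ (dZ j g) z w = (fderiv ℝ (fderiv ℝ g) z w (ee j) -
      Complex.I * fderiv ℝ (fderiv ℝ g) z w (Complex.I • ee j)) / 2 := by
    intro w
    have hfun : dZ j g = fun y => (fderiv ℝ g y (ee j) -
        Complex.I * fderiv ℝ g y (Complex.I • ee j)) * (2 : ℂ)⁻¹ :=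
      funext fun y => div_eq_mul_inv _ _
    rw [hfun, (((hda (ee j)).hasFDerivAt.fun_sub
        ((hda (Complex.I • ee j)).hasFDerivAt.const_mul Complex.I)).mul_const (2 : ℂ)⁻¹).fderiv]
    simp [h2, div_eq_inv_mul]
  have e2 : ∀ w, fderiv ℝ (dZb k g) z w = (fderiv ℝ (fderiv ℝ g) z w (ee k) +
      Complex.I * fderiv ℝ (fderiv ℝ g) z w (Complex.I • ee k)) / 2 := by
    intro w
    have hfun : dZb k g = fun y => (fderiv ℝ g y (ee k) +
        Complex.I * fderiv ℝ g y (Complex.I • ee k)) * (2 : ℂ)⁻¹ :=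
      funext fun y => div_eq_mul_inv _ _
    rw [hfun, (((hda (ee k)).hasFDerivAt.fun_add
        ((hda (Complex.I • ee k)).hasFDerivAt.const_mul Complex.I)).mul_const (2 : ℂ)⁻¹).fderiv]
    simp [h2, div_eq_inv_mul, mul_add]
  rw [dZb, dZ]
  simp only [e1, e2]
  rw [hs (ee j) (ee k), hs (ee j) (Complex.I • ee k), hs (Complex.I • ee j) (ee k),
    hs (Complex.I • ee j) (Complex.I • ee k)]
  ring

/-- The weak form of `∂∂̄(a ∧ ∂̄p) = -∂̄a ∧ ∂∂̄p`, for a `(1,0)`-form `a` with `∂̄a = -∂b`. -/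
theorem integral_wedge2_hess {a b : Fin 2 → ℂ × ℂ → ℂ} {p φ : ℂ × ℂ → ℂ}
    (ha : ∀ j, ContDiff ℝ 1 (a j)) (hb : ∀ j, ContDiff ℝ 1 (b j))
    (hab : ∀ j k z, dZb k (a j) z = dZ j (b k) z) (hp : ContDiff ℝ 2 p) (hφ : ContDiff ℝ 2 φ)
    (hc : HasCompactSupport φ) :
    ∫ z, wedge2 (fun j k z => a j z * dZb k p z) (hess φ) z =
      -∫ z, φ z * wedge2 (fun j k => dZ j (b k)) (hess p) z := by
  have hp1 : ∀ k, ContDiff ℝ 1 (dZb k p) := fun k => hp.dZb (by norm_num) k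
  have hφ1 : ∀ k, ContDiff ℝ 1 (dZ k φ) := fun k => hφ.dZ (by norm_num) k
  have hφl : ContDiff ℝ 1 φ := hφ.of_le (by norm_num)
  have hη : ∀ j l, ContDiff ℝ 1 fun z => a j z * dZ l φ z := fun j l => (ha j).mul (hφ1 l)
  have hηc : ∀ j l, HasCompactSupport fun z => a j z * dZ l φ z := fun j l => (hc.dZ l).mul_left
  have hθ : ∀ k, ContDiff ℝ 1 fun z => dZb k p z * φ z := fun k => (hp1 k).mul hφl
  have hθc : ∀ k, HasCompactSupport fun z => dZb k p z * φ z := fun k => hc.mul_left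
  have I1 : ∀ j l k m, Integrable fun z => dZb k p z * dZb m (fun u => a j u * dZ l φ u) z :=
    fun j l k m => Continuous.integrable_of_hasCompactSupport
      ((hp1 k).continuous.mul ((hη j l).dZb (m := 0) (by norm_num) m).continuous)
      ((hηc j l).dZb m).mul_left
  have I2 : ∀ m k j l, Integrable fun z => dZ j (b m) z * dZ l (fun u => dZb k p u * φ u) z :=
    fun m k j l => Continuous.integrable_of_hasCompactSupport
      (((hb m).dZ (m := 0) (by norm_num) j).continuous.mul
        ((hθ k).dZ (m := 0) (by norm_num) l).continuous)
      ((hθc k).dZ l).mul_left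
  have E1 : ∀ j l, ∫ z, (dZb 0 p z * dZb 1 (fun u => a j u * dZ l φ u) z -
      dZb 1 p z * dZb 0 (fun u => a j u * dZ l φ u) z) = 0 := fun j l => by
    rw [integral_sub (I1 _ _ _ _) (I1 _ _ _ _), sub_eq_zero]
    exact integral_dZb_mul_dZb_comm (hp.of_le (by norm_num)) (hη j l) (hηc j l) 0 1
  have E2 : ∀ m k, ∫ z, (dZ 0 (b m) z * dZ 1 (fun u => dZb k p u * φ u) z -
      dZ 1 (b m) z * dZ 0 (fun u => dZb k p u * φ u) z) = 0 := fun m k => by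
    rw [integral_sub (I2 _ _ _ _) (I2 _ _ _ _), sub_eq_zero]
    exact integral_dZ_mul_dZ_comm (hb m) (hθ k) (hθc k) 0 1
  have J1 : ∀ j l, Integrable fun z => dZb 0 p z * dZb 1 (fun u => a j u * dZ l φ u) z -
      dZb 1 p z * dZb 0 (fun u => a j u * dZ l φ u) z :=
    fun j l => (I1 j l 0 1).sub (I1 j l 1 0)
  have J2 : ∀ m k, Integrable fun z => dZ 0 (b m) z * dZ 1 (fun u => dZb k p u * φ u) z -
      dZ 1 (b m) z * dZ 0 (fun u => dZb k p u * φ u) z :=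
    fun m k => (I2 m k 0 1).sub (I2 m k 1 0)
  have hh : ∀ j k, Continuous (hess p j k) := fun j k =>
    ((hp1 k).dZ (m := 0) (by norm_num) j).continuous
  have hbh : ∀ j k, Continuous (dZ j (b k)) := fun j k =>
    ((hb k).dZ (m := 0) (by norm_num) j).continuous
  have JR : Integrable fun z => φ z * wedge2 (fun j k => dZ j (b k)) (hess p) z := by
    refine Continuous.integrable_of_hasCompactSupport ?_ hc.mul_right
    unfold wedge2
    have := hφ.continuous
    fun_prop
  have step : ∀ z, wedge2 (fun j k z => a j z * dZb k p z) (hess φ) z =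
      (((dZb 0 p z * dZb 1 (fun u => a 0 u * dZ 1 φ u) z -
        dZb 1 p z * dZb 0 (fun u => a 0 u * dZ 1 φ u) z) -
      (dZb 0 p z * dZb 1 (fun u => a 1 u * dZ 0 φ u) z -
        dZb 1 p z * dZb 0 (fun u => a 1 u * dZ 0 φ u) z)) -
      ((dZ 0 (b 1) z * dZ 1 (fun u => dZb 0 p u * φ u) z -
        dZ 1 (b 1) z * dZ 0 (fun u => dZb 0 p u * φ u) z) -
      (dZ 0 (b 0) z * dZ 1 (fun u => dZb 1 p u * φ u) z -
        dZ 1 (b 0) z * dZ 0 (fun u => dZb 1 p u * φ u) z))) -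
      φ z * wedge2 (fun j k => dZ j (b k)) (hess p) z := by
    intro z
    simp only [dZb_mul (ha _) (hφ1 _), dZ_mul (hp1 _) hφl, hab, dZb_dZ_comm hφ, wedge2, hess]
    ring
  simp only [step]
  rw [integral_sub₅ (J1 0 1) (J1 1 0) (J2 1 0) (J2 0 1) JR, E1, E1, E2, E2]
  simp

theorem fderiv_ofReal_comp {ρ : ℂ × ℂ → ℝ} {z : ℂ × ℂ} (hρ : DifferentiableAt ℝ ρ z)
    {f : ℝ → ℝ} (hf : DifferentiableAt ℝ f (ρ z)) (w : ℂ × ℂ) :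
    fderiv ℝ (fun u => (f (ρ u) : ℂ)) z w =
      ((deriv f (ρ z) : ℝ) : ℂ) * fderiv ℝ (fun u => (ρ u : ℂ)) z w := by
  have h1 : HasFDerivAt (fun u => (ρ u : ℂ)) (Complex.ofRealCLM.comp (fderiv ℝ ρ z)) z :=
    Complex.ofRealCLM.hasFDerivAt.comp z hρ.hasFDerivAt
  have h2 : HasFDerivAt (fun u => (f (ρ u) : ℂ))
      (Complex.ofRealCLM.comp (deriv f (ρ z) • fderiv ℝ ρ z)) z :=
    Complex.ofRealCLM.hasFDerivAt.comp z (hf.hasDerivAt.comp_hasFDerivAt z hρ.hasFDerivAt)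
  rw [h1.fderiv, h2.fderiv]
  simp

theorem integral_wedge2_grd_hess {ρ : ℂ × ℂ → ℝ} (hρ : ContDiff ℝ 2 ρ) {f : ℝ → ℝ}
    (hf : ContDiff ℝ 1 f) {φ : ℂ × ℂ → ℂ} (hφ : ContDiff ℝ 2 φ) (hc : HasCompactSupport φ) :
    ∫ z, f (ρ z) • wedge2 (grd ρ) (hess φ) z =
      -∫ z, φ z * (((deriv f (ρ z) : ℝ) : ℂ) * wedge2 (hess fun u => (ρ u : ℂ)) (grd ρ) z +
        f (ρ z) * wedge2 (hess fun u => (ρ u : ℂ)) (hess fun u => (ρ u : ℂ)) z) := by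
  have hp : ContDiff ℝ 2 fun u => (ρ u : ℂ) := Complex.ofRealCLM.contDiff.comp hρ
  have hF : ContDiff ℝ 1 fun u => (f (ρ u) : ℂ) :=
    Complex.ofRealCLM.contDiff.comp (hf.comp (hρ.of_le (by norm_num)))
  have hp1 : ∀ k, ContDiff ℝ 1 (dZ k fun u => (ρ u : ℂ)) := fun k => hp.dZ (by norm_num) k
  have hp1' : ∀ k, ContDiff ℝ 1 (dZb k fun u => (ρ u : ℂ)) := fun k => hp.dZb (by norm_num) k
  have hfd := fun z => fderiv_ofReal_comp (hρ.differentiable (by norm_num) z)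
    (hf.differentiable one_ne_zero (ρ z))
  have hdZ : ∀ j z, dZ j (fun u => (f (ρ u) : ℂ)) z =
      ((deriv f (ρ z) : ℝ) : ℂ) * dZ j (fun u => (ρ u : ℂ)) z := fun j z => by
    simp only [dZ, hfd]; ring
  have hdZb : ∀ j z, dZb j (fun u => (f (ρ u) : ℂ)) z =
      ((deriv f (ρ z) : ℝ) : ℂ) * dZb j (fun u => (ρ u : ℂ)) z := fun j z => by
    simp only [dZb, hfd]; ring
  have key := integral_wedge2_hess
    (a := fun j u => (f (ρ u) : ℂ) * dZ j (fun u => (ρ u : ℂ)) u)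
    (b := fun j u => (f (ρ u) : ℂ) * dZb j (fun u => (ρ u : ℂ)) u)
    (fun j => hF.mul (hp1 j)) (fun j => hF.mul (hp1' j))
    (fun j k z => by
      rw [dZb_mul hF (hp1 j), dZ_mul hF (hp1' k), hdZ, hdZb, dZb_dZ_comm hp]
      ring) hp hφ hc
  convert key using 2
  · ext z
    simp only [wedge2, grd, Complex.real_smul]
    ring
  · congr 1 with z
    simp only [wedge2, dZ_mul hF (hp1' _), hdZ, grd, hess]
    ring

theorem volume_ball_inter_le_of_le_fderiv {ρ : ℂ × ℂ → ℝ} (hρ : ContDiff ℝ 1 ρ) {z₀ v : ℂ × ℂ}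
    {r c : ℝ} (hc : 0 < c) (hv : ∀ z ∈ Metric.ball z₀ r, c ≤ fderiv ℝ ρ z v) (ε : ℝ) :
    volume (Metric.ball z₀ r ∩ {z | |ρ z| ≤ ε}) ≤
      ENNReal.ofReal (2 * ε / c) * volume (Metric.ball z₀ (r + ‖v‖)) := by
  set A := Metric.ball z₀ r ∩ {z | |ρ z| ≤ ε}
  have hρc := hρ.continuous
  have hAm : MeasurableSet A := measurableSet_ball.inter
    (isClosed_le (by fun_prop) (by fun_prop)).measurableSet
  set W : Set (ℝ × (ℂ × ℂ)) := {q | q.1 ∈ Set.Icc (0 : ℝ) 1 ∧ q.2 + q.1 • v ∈ A} with hW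
  have hWm : MeasurableSet W := by
    refine MeasurableSet.inter (measurable_fst measurableSet_Icc) ?_
    have : Measurable fun q : ℝ × (ℂ × ℂ) => q.2 + q.1 • v :=
      Continuous.measurable (by fun_prop)
    exact this hAm
  have h1 : ((volume : Measure ℝ).prod (volume : Measure (ℂ × ℂ))) W = volume A := by
    rw [Measure.prod_apply hWm]
    have : ∀ t : ℝ, volume (Prod.mk t ⁻¹' W) =
        (Set.Icc (0 : ℝ) 1).indicator (fun _ => volume A) t := by
      intro t
      by_cases ht : t ∈ Set.Icc (0 : ℝ) 1
      · rw [Set.indicator_of_mem ht, ← measure_preimage_add_right volume (t • v) A]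
        congr 1
        ext z
        simp only [hW, Set.mem_preimage, Set.mem_ofPred_eq, ht, true_and]
      · rw [Set.indicator_of_notMem ht, ← measure_empty (μ := (volume : Measure (ℂ × ℂ)))]
        congr 1
        ext z
        simp only [hW, Set.mem_preimage, Set.mem_ofPred_eq, ht, false_and,
          Set.mem_empty_iff_false]
    simp only [this]
    rw [lintegral_indicator measurableSet_Icc]
    simp
  have h2 : ∀ z, volume ((fun t : ℝ => (t, z)) ⁻¹' W) ≤
      (Metric.ball z₀ (r + ‖v‖)).indicator (fun _ => ENNReal.ofReal (2 * ε / c)) z := by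
    intro z
    by_cases hz : z ∈ Metric.ball z₀ (r + ‖v‖)
    · rw [Set.indicator_of_mem hz]
      refine (Real.volume_le_diam _).trans (Metric.ediam_le fun t ht s hs => ?_)
      wlog hst : s ≤ t generalizing s t
      · rw [edist_comm]; exact this s hs t ht (le_of_not_ge hst)
      have hline : ∀ x : ℝ, HasDerivAt (fun x : ℝ => ρ (z + x • v)) (fderiv ℝ ρ (z + x • v) v) x := by
        intro x
        have hl : HasDerivAt (fun t : ℝ => z + t • v) v x := by
          simpa using ((hasDerivAt_id x).smul_const v).const_add z
        exact ((hρ.differentiable one_ne_zero _).hasFDerivAt).comp_hasDerivAt x hl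
      have hconv : Convex ℝ {x : ℝ | z + x • v ∈ Metric.ball z₀ r} := by
        intro x hx y hy a b ha hb hab
        have := convex_ball z₀ r hx hy ha hb hab
        have h : a • (z + x • v) + b • (z + y • v) = z + (a • x + b • y) • v := by
          have hz : z = a • z + b • z := by rw [← add_smul, hab, one_smul]
          conv_rhs => rw [hz]
          simp only [smul_eq_mul]
          module
        rw [h] at this
        exact this
      have hmv := hconv.mul_sub_le_image_sub_of_le_deriv (f := fun x : ℝ => ρ (z + x • v))
        (fun x _ => (hline x).continuousAt.continuousWithinAt)
        (fun x _ => (hline x).differentiableAt.differentiableWithinAt) (C := c)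
        (fun x hx => by
          rw [(hline x).deriv]
          exact hv _ (interior_subset (s := {x : ℝ | z + x • v ∈ Metric.ball z₀ r}) hx))
        s hs.2.1 t ht.2.1 hst
      have hs₁ : |ρ (z + s • v)| ≤ ε := hs.2.2
      have ht₁ : |ρ (z + t • v)| ≤ ε := ht.2.2
      have hs' := abs_le.1 hs₁
      have ht' := abs_le.1 ht₁
      rw [edist_dist]
      apply ENNReal.ofReal_le_ofReal
      rw [Real.dist_eq, abs_of_nonneg (by linarith), le_div_iff₀ hc]
      linarith
    · rw [Set.indicator_of_notMem hz, nonpos_iff_eq_zero,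
        ← measure_empty (μ := (volume : Measure ℝ))]
      congr 1
      refine Set.eq_empty_of_forall_notMem fun t ht => hz ?_
      have ht1 : |t| ≤ 1 := abs_le.2 ⟨by linarith [ht.1.1], ht.1.2⟩
      have hb : ‖z + t • v - z₀‖ < r := mem_ball_iff_norm.1 ht.2.1
      rw [mem_ball_iff_norm]
      calc ‖z - z₀‖ = ‖(z + t • v - z₀) - t • v‖ := by congr 1; abel
        _ ≤ ‖z + t • v - z₀‖ + ‖t • v‖ := norm_sub_le _ _
        _ < r + ‖v‖ := by
          rw [norm_smul, Real.norm_eq_abs]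
          have := mul_le_of_le_one_left (norm_nonneg v) ht1
          linarith
  calc volume A = ((volume : Measure ℝ).prod (volume : Measure (ℂ × ℂ))) W := h1.symm
    _ = ∫⁻ z, volume ((fun t : ℝ => (t, z)) ⁻¹' W) := Measure.prod_apply_symm hWm
    _ ≤ ∫⁻ z, (Metric.ball z₀ (r + ‖v‖)).indicator (fun _ => ENNReal.ofReal (2 * ε / c)) z :=
      lintegral_mono h2
    _ = _ := by rw [lintegral_indicator measurableSet_ball]; simp

/-- The tubes `{|ρ| ≤ ε}` around a regular level set have volume `O(ε)` on compact sets. -/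
theorem exists_volume_inter_abs_le {ρ : ℂ × ℂ → ℝ} (hρ : ContDiff ℝ 1 ρ)
    (hnv : ∀ z, ρ z = 0 → fderiv ℝ ρ z ≠ 0) {K : Set (ℂ × ℂ)} (hK : IsCompact K) :
    ∃ C : NNReal, ∀ ε : ℝ, 0 < ε → volume (K ∩ {z | |ρ z| ≤ ε}) ≤ C * ENNReal.ofReal ε := by
  have hρc := hρ.continuous
  have hρ' : Continuous (fderiv ℝ ρ) := hρ.continuous_fderiv one_ne_zero
  refine hK.induction_on (p := fun S => ∃ C : NNReal, ∀ ε : ℝ, 0 < ε →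
    volume (S ∩ {z | |ρ z| ≤ ε}) ≤ C * ENNReal.ofReal ε) ⟨0, by simp⟩ ?_ ?_ ?_
  · rintro s t hst ⟨C, hC⟩
    exact ⟨C, fun ε hε => (measure_mono (Set.inter_subset_inter_left _ hst)).trans (hC ε hε)⟩
  · rintro s t ⟨C, hC⟩ ⟨D, hD⟩
    refine ⟨C + D, fun ε hε => ?_⟩
    rw [Set.union_inter_distrib_right, ENNReal.coe_add, add_mul]
    exact (measure_union_le _ _).trans (add_le_add (hC ε hε) (hD ε hε))
  · intro z₀ _
    by_cases h0 : ρ z₀ = 0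
    · obtain ⟨v, hv⟩ : ∃ v, 0 < fderiv ℝ ρ z₀ v := by
        obtain ⟨v, hv⟩ := DFunLike.ne_iff.1 (hnv z₀ h0)
        rcases lt_or_gt_of_ne hv with h | h
        · exact ⟨-v, by simpa using h⟩
        · exact ⟨v, by simpa using h⟩
      have hev : ∀ᶠ z in nhds z₀, fderiv ℝ ρ z₀ v / 2 < fderiv ℝ ρ z v :=
        (Continuous.continuousAt (by fun_prop : Continuous fun z => fderiv ℝ ρ z v)).eventually_const_lt
          (by linarith)
      obtain ⟨r, hr, hball⟩ := Metric.eventually_nhds_iff_ball.1 hev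
      refine ⟨Metric.ball z₀ r, mem_nhdsWithin_of_mem_nhds (Metric.ball_mem_nhds _ hr), ?_⟩
      refine ⟨(ENNReal.ofReal (2 / (fderiv ℝ ρ z₀ v / 2)) *
        volume (Metric.ball z₀ (r + ‖v‖))).toNNReal, fun ε hε => ?_⟩
      rw [ENNReal.coe_toNNReal (ENNReal.mul_ne_top ENNReal.ofReal_ne_top measure_ball_lt_top.ne)]
      refine (volume_ball_inter_le_of_le_fderiv hρ (half_pos hv)
        (fun z hz => (hball z hz).le) ε).trans (le_of_eq ?_)
      rw [mul_right_comm, ← ENNReal.ofReal_mul (by positivity)]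
      congr 2
      ring
    · have hpos : 0 < |ρ z₀| / 2 := half_pos (abs_pos.2 h0)
      have hev : ∀ᶠ z in nhds z₀, |ρ z₀| / 2 < |ρ z| :=
        (Continuous.continuousAt (by fun_prop : Continuous fun z => |ρ z|)).eventually_const_lt
          (by linarith)
      obtain ⟨r, hr, hball⟩ := Metric.eventually_nhds_iff_ball.1 hev
      refine ⟨Metric.ball z₀ r, mem_nhdsWithin_of_mem_nhds (Metric.ball_mem_nhds _ hr), ?_⟩
      refine ⟨(ENNReal.ofReal (1 / (|ρ z₀| / 2)) *
        volume (Metric.ball z₀ r)).toNNReal, fun ε hε => ?_⟩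
      rw [ENNReal.coe_toNNReal (ENNReal.mul_ne_top ENNReal.ofReal_ne_top measure_ball_lt_top.ne)]
      rcases lt_or_ge ε (|ρ z₀| / 2) with h | h
      · rw [(Set.eq_empty_of_forall_notMem fun z hz =>
          absurd ((hball z hz.1).trans_le hz.2) (not_lt.2 h.le) :
          Metric.ball z₀ r ∩ {z | |ρ z| ≤ ε} = ∅), measure_empty]
        exact zero_le
      · rw [mul_right_comm, ← ENNReal.ofReal_mul (by positivity)]
        refine (measure_mono Set.inter_subset_left).trans (le_mul_of_one_le_left zero_le ?_)
        rw [← ENNReal.ofReal_one]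
        apply ENNReal.ofReal_le_ofReal
        rw [one_div, inv_mul_eq_div, le_div_iff₀ hpos]
        linarith

theorem eventually_norm_le_on_tube {ρ : ℂ × ℂ → ℝ} (hρ : Continuous ρ) {K : Set (ℂ × ℂ)}
    (hK : IsCompact K) {h : ℂ × ℂ → ℂ} (hh : Continuous h) (h0 : ∀ z, ρ z = 0 → h z = 0)
    {δ : ℝ} (hδ : 0 < δ) :
    ∀ᶠ ε in nhdsWithin (0 : ℝ) (Set.Ioi 0), ∀ z ∈ K, |ρ z| ≤ ε → ‖h z‖ ≤ δ := by
  have hL : IsCompact (K ∩ {z | δ ≤ ‖h z‖}) :=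
    hK.inter_right (isClosed_le continuous_const hh.norm)
  have hpos : ∃ e > 0, ∀ z ∈ K ∩ {z | δ ≤ ‖h z‖}, e ≤ |ρ z| := by
    rcases (K ∩ {z | δ ≤ ‖h z‖}).eq_empty_or_nonempty with he | hne
    · exact ⟨1, one_pos, by simp [he]⟩
    · obtain ⟨w, hw, hmin⟩ := hL.exists_isMinOn hne (f := fun z => |ρ z|) (by fun_prop)
      refine ⟨|ρ w|, abs_pos.2 fun hw0 => ?_, fun z hz => hmin hz⟩
      have : δ ≤ ‖h w‖ := hw.2
      rw [h0 w hw0, norm_zero] at this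
      linarith
  obtain ⟨e, he, hmin⟩ := hpos
  filter_upwards [nhdsWithin_le_nhds (Iio_mem_nhds he)] with ε hε z hz hρz
  by_contra! hlt
  exact absurd ((hmin z ⟨hz, hlt.le⟩).trans hρz) (not_le.2 hε)

/-- Proposition 6.16: let `ρ` be real `C²` with `∂ρ ≠ 0` on `X = {ρ = 0}`,
`(i∂∂̄ρ)² = 0` on `X` and `i∂∂̄ρ ∧ ∂ρ ∧ ∂̄ρ = O(ρ²)` (on compact sets). For
`χ ∈ C₀^∞(−1,1)`, `χ ≥ 0`, `∫χ = 1`, set `T_ε = (1/ε) χ(ρ/ε) ∂ρ ∧ ∂̄ρ`. Then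
`⟨T_ε, i∂∂̄φ⟩ → 0` as `ε → 0⁺` for every test function `φ`, i.e. `i∂∂̄T_ε → 0`,
so the limit current `T = i δ_{ρ=0} ∂ρ ∧ ∂̄ρ` is harmonic. -/
theorem stmt_10 (ρ : ℂ × ℂ → ℝ) (hρ : ContDiff ℝ 2 ρ)
    (hnv : ∀ z, ρ z = 0 → fderiv ℝ ρ z ≠ 0)
    (hMA : ∀ z, ρ z = 0 →
      hess (fun u => (ρ u : ℂ)) 0 0 z * hess (fun u => (ρ u : ℂ)) 1 1 z -
        hess (fun u => (ρ u : ℂ)) 0 1 z * hess (fun u => (ρ u : ℂ)) 1 0 z = 0)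
    (hO : ∀ K : Set (ℂ × ℂ), IsCompact K → ∃ c : ℝ, ∀ z ∈ K,
      ‖wedge2 (hess (fun u => (ρ u : ℂ))) (grd ρ) z‖ ≤ c * (ρ z) ^ 2)
    (χ : ℝ → ℝ) (hχ : ContDiff ℝ (⊤ : ℕ∞) χ)
    (hχsupp : Function.support χ ⊆ Set.Ioo (-1) 1)
    (hχpos : ∀ t, 0 ≤ χ t) (hχint : ∫ t, χ t = 1)
    (φ : ℂ × ℂ → ℂ) (hφ : ContDiff ℝ (⊤ : ℕ∞) φ) (hφsupp : HasCompactSupport φ) :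
    Tendsto
      (fun ε : ℝ =>
        ∫ z : ℂ × ℂ, ((1 / ε) * χ (ρ z / ε)) • wedge2 (grd ρ) (hess φ) z)
      (nhdsWithin 0 (Set.Ioi 0)) (nhds 0) := by
  have hρ1 : ContDiff ℝ 1 ρ := hρ.of_le (by norm_num)
  have hp : ContDiff ℝ 2 fun u => (ρ u : ℂ) := Complex.ofRealCLM.contDiff.comp hρ
  have hφ2 : ContDiff ℝ 2 φ := contDiff_infty.1 hφ 2
  have hχ1 : ContDiff ℝ 1 χ := contDiff_infty.1 hχ 1
  have hts : tsupport χ ⊆ Set.Icc (-1) 1 :=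
    closure_minimal (hχsupp.trans Set.Ioo_subset_Icc_self) isClosed_Icc
  have hχc : HasCompactSupport χ := isCompact_Icc.of_isClosed_subset (isClosed_tsupport χ) hts
  have hχ0 : ∀ t, 1 < |t| → χ t = 0 := fun t ht =>
    image_eq_zero_of_notMem_tsupport fun h => absurd (abs_le.2 (hts h)) (not_le.2 ht)
  have hχ0' : ∀ t, 1 < |t| → deriv χ t = 0 := fun t ht => by
    refine image_eq_zero_of_notMem_tsupport (f := deriv χ) fun h => ?_
    exact absurd (abs_le.2 (hts (tsupport_deriv_subset h))) (not_le.2 ht)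
  obtain ⟨M, hM⟩ := hχc.exists_bound_of_continuous hχ1.continuous
  obtain ⟨M', hM'⟩ := hχc.deriv.exists_bound_of_continuous (hχ1.continuous_deriv le_rfl)
  obtain ⟨N, hN⟩ := hφsupp.exists_bound_of_continuous hφ.continuous
  have hM0 : 0 ≤ M := (norm_nonneg _).trans (hM 0)
  have hM0' : 0 ≤ M' := (norm_nonneg _).trans (hM' 0)
  have hN0 : 0 ≤ N := (norm_nonneg _).trans (hN 0)
  obtain ⟨c, hc⟩ := hO (tsupport φ) hφsupp
  obtain ⟨C, hC⟩ := exists_volume_inter_abs_le hρ1 hnv hφsupp.isCompact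
  have hhess : ∀ j k, Continuous (hess (fun u => (ρ u : ℂ)) j k) := fun j k =>
    ((hp.dZb (m := 1) (by norm_num) k).dZ (m := 0) (by norm_num) j).continuous
  set D := wedge2 (hess fun u => (ρ u : ℂ)) (hess fun u => (ρ u : ℂ)) with hD
  have hDc : Continuous D := by
    rw [hD]; unfold wedge2; fun_prop
  have hD0 : ∀ z, ρ z = 0 → D z = 0 := fun z hz => by
    simp only [hD, wedge2]
    linear_combination 2 * hMA z hz
  have bound : ∀ δ : ℝ, 0 < δ → ∀ᶠ ε in nhdsWithin (0 : ℝ) (Set.Ioi 0),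
      ‖∫ z : ℂ × ℂ, ((1 / ε) * χ (ρ z / ε)) • wedge2 (grd ρ) (hess φ) z‖ ≤
        N * M' * |c| * C * ε + N * M * C * δ := by
    intro δ hδ
    filter_upwards [eventually_norm_le_on_tube hρ.continuous hφsupp.isCompact hDc hD0 hδ,
      self_mem_nhdsWithin] with ε hDε hε
    have hε : 0 < ε := hε
    have hf : ContDiff ℝ 1 fun t => 1 / ε * χ (t / ε) :=
      contDiff_const.mul (hχ1.comp (contDiff_id.div_const ε))
    have hdf : ∀ t, deriv (fun t => 1 / ε * χ (t / ε)) t = 1 / ε ^ 2 * deriv χ (t / ε) := by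
      intro t
      have h := (((hχ1.differentiable one_ne_zero (t / ε)).hasDerivAt.comp t
        ((hasDerivAt_id t).div_const ε)).const_mul (1 / ε)).deriv
      refine h.trans ?_
      field_simp
    rw [integral_wedge2_grd_hess hρ hf hφ2 hφsupp, norm_neg]
    simp only [hdf, ← hD]
    have hset : ∀ z, z ∉ tsupport φ ∩ {z | |ρ z| ≤ ε} →
        φ z * (((1 / ε ^ 2 * deriv χ (ρ z / ε) : ℝ) : ℂ) *
          wedge2 (hess fun u => (ρ u : ℂ)) (grd ρ) z +
            ((1 / ε * χ (ρ z / ε) : ℝ) : ℂ) * D z) = 0 := by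
      intro z hz
      by_cases hzφ : z ∈ tsupport φ
      · have : 1 < |ρ z / ε| := by
          rw [abs_div, abs_of_pos hε, one_lt_div hε]
          exact not_le.1 fun h => hz ⟨hzφ, h⟩
        rw [hχ0 _ this, hχ0' _ this]
        simp
      · rw [image_eq_zero_of_notMem_tsupport hzφ, zero_mul]
    rw [← setIntegral_eq_integral_of_forall_compl_eq_zero hset]
    have hvol := hC ε hε
    have hfin : (C : ENNReal) * ENNReal.ofReal ε < ⊤ :=
      ENNReal.mul_lt_top ENNReal.coe_lt_top ENNReal.ofReal_lt_top
    have hreal : volume.real (tsupport φ ∩ {z | |ρ z| ≤ ε}) ≤ C * ε := by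
      have := ENNReal.toReal_mono hfin.ne hvol
      simpa [Measure.real, ENNReal.toReal_mul, ENNReal.toReal_ofReal hε.le] using this
    have hpt : ∀ z ∈ tsupport φ ∩ {z | |ρ z| ≤ ε},
        ‖φ z * (((1 / ε ^ 2 * deriv χ (ρ z / ε) : ℝ) : ℂ) *
          wedge2 (hess fun u => (ρ u : ℂ)) (grd ρ) z +
            ((1 / ε * χ (ρ z / ε) : ℝ) : ℂ) * D z)‖ ≤ N * (M' * |c| + 1 / ε * M * δ) := by
      rintro z ⟨hzφ, hzρ⟩
      have hw : ‖wedge2 (hess fun u => (ρ u : ℂ)) (grd ρ) z‖ ≤ |c| * ε ^ 2 := by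
        refine (hc z hzφ).trans ?_
        have : (ρ z) ^ 2 ≤ ε ^ 2 := sq_le_sq.2 (by rwa [abs_of_pos hε])
        exact mul_le_mul (le_abs_self c) this (sq_nonneg _) (abs_nonneg c)
      have t1 : ‖((1 / ε ^ 2 * deriv χ (ρ z / ε) : ℝ) : ℂ) *
          wedge2 (hess fun u => (ρ u : ℂ)) (grd ρ) z‖ ≤ M' * |c| := by
        rw [norm_mul, Complex.norm_real, norm_mul, Real.norm_of_nonneg (by positivity)]
        calc 1 / ε ^ 2 * ‖deriv χ (ρ z / ε)‖ * ‖wedge2 (hess fun u => (ρ u : ℂ)) (grd ρ) z‖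
            ≤ 1 / ε ^ 2 * M' * (|c| * ε ^ 2) := by
              gcongr
              exact hM' _
          _ = M' * |c| := by field_simp
      have t2 : ‖((1 / ε * χ (ρ z / ε) : ℝ) : ℂ) * D z‖ ≤ 1 / ε * M * δ := by
        rw [norm_mul, Complex.norm_real, norm_mul, Real.norm_of_nonneg (by positivity)]
        gcongr
        · exact hM _
        · exact hDε z hzφ hzρ
      rw [norm_mul]
      exact mul_le_mul (hN z) ((norm_add_le _ _).trans (add_le_add t1 t2)) (norm_nonneg _) hN0
    calc _ ≤ N * (M' * |c| + 1 / ε * M * δ) * volume.real (tsupport φ ∩ {z | |ρ z| ≤ ε}) :=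
          norm_setIntegral_le_of_norm_le_const (hvol.trans_lt hfin) hpt
      _ ≤ N * (M' * |c| + 1 / ε * M * δ) * (C * ε) := by gcongr
      _ = _ := by field_simp
  rw [Metric.tendsto_nhds]
  intro η hη
  set P := N * M' * |c| * C with hP
  set Q := N * M * C with hQ
  have hP0 : 0 ≤ P := by positivity
  have hQ0 : 0 ≤ Q := by positivity
  have hδ : 0 < η / (2 * (Q + 1)) := by positivity
  have hε₀ : 0 < η / (2 * (P + 1)) := by positivity
  filter_upwards [bound _ hδ, nhdsWithin_le_nhds (Iio_mem_nhds hε₀), self_mem_nhdsWithin]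
    with ε hb hε hε0
  rw [dist_zero_right]
  have hε : ε < η / (2 * (P + 1)) := hε
  have hε0 : 0 < ε := hε0
  have h1 : P * ε < η / 2 := by
    rw [lt_div_iff₀ (by positivity)] at hε
    nlinarith
  have h2 : Q * (η / (2 * (Q + 1))) ≤ η / 2 := by
    rw [mul_div_assoc', div_le_div_iff₀ (by positivity) two_pos]
    nlinarith
  linarith

end
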